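/- Let p ∈ [3,5) and β = 1 − 2/(p−1). Suppose w(r,t) satisfies the d'Alembert representation with initial data w(r,0) = c r^β for r ≥ 1, w_t(r,0) = 0, and the a priori bound |w(r,t)| ≤ 3c r^β for r ≥ 1 + t. Then for c sufficiently small (depending only on p), w(r,t) ≥ (c/2) r^β for all r ≥ 1 + t ≥ 1, and hence u(r,t) = w(r,t)/r satisfies u(r,t) ≥ (c/2) r^{−2/(p−1)} there. -/

import Mathlib

open MeasureTheory

/-- The triangular region `Ω(r,t)` for the d'Alembert representation. -/
def dAlembertRegion (r t : ℝ) : Set (ℝ × ℝ) :=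
  {z : ℝ × ℝ | z.1 + z.2 < r + t ∧ z.2 - z.1 < t - r ∧ 0 < z.2}


lemma isOpen_region (r t : ℝ) : IsOpen (dAlembertRegion r t) := by
  unfold dAlembertRegion
  have o1 : IsOpen {z : ℝ × ℝ | z.1 + z.2 < r + t} := isOpen_lt (by fun_prop) (by fun_prop)
  have o2 : IsOpen {z : ℝ × ℝ | z.2 - z.1 < t - r} := isOpen_lt (by fun_prop) (by fun_prop)
  have o3 : IsOpen {z : ℝ × ℝ | 0 < z.2} := isOpen_lt (by fun_prop) (by fun_prop)
  exact o1.and (o2.and o3)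

lemma region_facts {r t : ℝ} {z : ℝ × ℝ} (h : z ∈ dAlembertRegion r t) :
    z.1 + z.2 < r + t ∧ z.2 - z.1 < t - r ∧ 0 < z.2 := h

lemma region_volume_le (r t : ℝ) (ht : 0 ≤ t) :
    volume (dAlembertRegion r t) ≤ ENNReal.ofReal (2 * t ^ 2) := by
  have hsub : dAlembertRegion r t ⊆ Set.Icc (r - t) (r + t) ×ˢ Set.Icc 0 t := by
    intro z hz
    obtain ⟨h1, h2, h3⟩ := region_facts hz
    refine ⟨⟨by linarith, by linarith⟩, ⟨by linarith, by linarith⟩⟩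
  refine (measure_mono hsub).trans ?_
  rw [Measure.volume_eq_prod, Measure.prod_prod, Real.volume_Icc, Real.volume_Icc,
    ← ENNReal.ofReal_mul (by linarith)]
  apply ENNReal.ofReal_le_ofReal
  nlinarith

lemma region_lintegral_le (β r t : ℝ) (h0 : 0 < β) (h1 : β < 1) (ht : 0 ≤ t) (hr : 1 + t ≤ r) :
    ∫⁻ z in dAlembertRegion r t, ENNReal.ofReal (z.1 ^ (β - 2)) ≤
      ENNReal.ofReal (r ^ β / (β * (1 - β))) := by
  have hm : MeasurableSet (dAlembertRegion r t) := (isOpen_region r t).measurableSet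
  rw [← lintegral_indicator hm, Measure.volume_eq_prod, lintegral_prod_symm]
  swap
  · apply Measurable.aemeasurable
    apply Measurable.indicator _ hm
    fun_prop
  have hin : ∀ s : ℝ, (∫⁻ x : ℝ, (dAlembertRegion r t).indicator
      (fun z : ℝ × ℝ => ENNReal.ofReal (z.1 ^ (β - 2))) (x, s)) ≤
      (Set.Ioc 0 t).indicator (fun s => ENNReal.ofReal ((r - t + s) ^ (β - 1) / (1 - β))) s := by
    intro s
    by_cases hs : s ∈ Set.Ioc 0 t
    · rw [Set.indicator_of_mem hs]
      have hpos : 0 < r - t + s := by linarith [hs.1]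
      have e : ENNReal.ofReal ((r - t + s) ^ (β - 1) / (1 - β)) =
          ∫⁻ x in Set.Ioi (r - t + s), ENNReal.ofReal (x ^ (β - 2)) := by
        rw [← ofReal_integral_eq_lintegral_ofReal
          (integrableOn_Ioi_rpow_of_lt (by linarith) hpos)]
        · rw [integral_Ioi_rpow_of_lt (by linarith) hpos]
          congr 1
          rw [show β - 2 + 1 = -(1 - β) by ring, show β - 1 = -(1 - β) by ring, neg_div_neg_eq]
        · filter_upwards [ae_restrict_mem measurableSet_Ioi] with x hx
          exact Real.rpow_nonneg (hpos.le.trans (le_of_lt hx)) _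
      rw [e, ← lintegral_indicator measurableSet_Ioi]
      apply lintegral_mono
      intro x
      by_cases hx : (x, s) ∈ dAlembertRegion r t
      · have hx2 : x ∈ Set.Ioi (r - t + s) := by
          have := (region_facts hx).2.1
          simp only [Set.mem_Ioi] at *
          linarith
        simp [Set.indicator_of_mem hx, Set.indicator_of_mem hx2]
      · simp [Set.indicator_of_notMem hx]
    · rw [Set.indicator_of_notMem hs]
      apply le_of_eq
      rw [lintegral_eq_zero_iff']
      · filter_upwards with x
        have : (x, s) ∉ dAlembertRegion r t := by
          intro hx
          obtain ⟨a, b, d⟩ := region_facts hx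
          simp only at a b d
          exact hs ⟨d, by linarith⟩
        simp [Set.indicator_of_notMem this]
      · apply Measurable.aemeasurable
        have : Measurable ((dAlembertRegion r t).indicator
          (fun z : ℝ × ℝ => ENNReal.ofReal (z.1 ^ (β - 2)))) := by
          apply Measurable.indicator _ hm
          fun_prop
        exact this.comp (by fun_prop)
  refine (lintegral_mono hin).trans ?_
  rw [lintegral_indicator measurableSet_Ioc]
  have hc : ContinuousOn (fun s : ℝ => (r - t + s) ^ (β - 1) / (1 - β)) (Set.uIcc 0 t) := by
    rw [Set.uIcc_of_le ht]
    apply ContinuousOn.div_const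
    apply ContinuousOn.rpow_const (by fun_prop)
    intro x hx
    left
    have := hx.1
    linarith
  rw [← ofReal_integral_eq_lintegral_ofReal
    ((intervalIntegrable_iff_integrableOn_Ioc_of_le ht).1 hc.intervalIntegrable)]
  · apply ENNReal.ofReal_le_ofReal
    rw [← intervalIntegral.integral_of_le ht, intervalIntegral.integral_div,
      intervalIntegral.integral_comp_add_left (fun x => x ^ (β - 1)), integral_rpow (by left; linarith)]
    rw [show r - t + t = r by ring, show β - 1 + 1 = β by ring, div_div]
    have : 0 ≤ (r - t + 0) ^ β := Real.rpow_nonneg (by linarith) _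
    have hb : 0 < β * (1 - β) := mul_pos h0 (by linarith)
    gcongr
    linarith
  · filter_upwards [ae_restrict_mem measurableSet_Ioc] with x hx
    exact div_nonneg (Real.rpow_nonneg (by linarith [hx.1]) _) (by linarith)

def wedge (a b α γ : ℝ) : Set (ℝ × ℝ) :=
  {z | a < z.1 ∧ z.1 < b ∧ α * z.1 < z.2 ∧ z.2 < γ * z.1}

lemma wedge_measurable (a b α γ : ℝ) : MeasurableSet (wedge a b α γ) := by
  apply IsOpen.measurableSet
  have o1 : IsOpen {z : ℝ × ℝ | a < z.1} := isOpen_lt (by fun_prop) (by fun_prop)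
  have o2 : IsOpen {z : ℝ × ℝ | z.1 < b} := isOpen_lt (by fun_prop) (by fun_prop)
  have o3 : IsOpen {z : ℝ × ℝ | α * z.1 < z.2} := isOpen_lt (by fun_prop) (by fun_prop)
  have o4 : IsOpen {z : ℝ × ℝ | z.2 < γ * z.1} := isOpen_lt (by fun_prop) (by fun_prop)
  exact o1.and (o2.and (o3.and o4))

lemma wedge_lintegral (a b α γ : ℝ) (ha : 0 < a) (hab : a ≤ b) (h : α ≤ γ) :
    ∫⁻ z in wedge a b α γ, ENNReal.ofReal (1 / z.1 ^ 2) =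
      ENNReal.ofReal ((γ - α) * Real.log (b / a)) := by
  have hm := wedge_measurable a b α γ
  rw [← lintegral_indicator hm, Measure.volume_eq_prod, lintegral_prod]
  swap
  · apply Measurable.aemeasurable
    apply Measurable.indicator _ hm
    fun_prop
  have hin : ∀ x : ℝ, (∫⁻ s : ℝ, (wedge a b α γ).indicator
      (fun z : ℝ × ℝ => ENNReal.ofReal (1 / z.1 ^ 2)) (x, s)) =
      (Set.Ioo a b).indicator (fun x => ENNReal.ofReal ((γ - α) * (1 / x))) x := by
    intro x
    by_cases hx : x ∈ Set.Ioo a b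
    · have hx0 : 0 < x := ha.trans hx.1
      have : (fun s : ℝ => (wedge a b α γ).indicator
        (fun z : ℝ × ℝ => ENNReal.ofReal (1 / z.1 ^ 2)) (x, s)) =
        (Set.Ioo (α * x) (γ * x)).indicator (fun _ => ENNReal.ofReal (1 / x ^ 2)) := by
        ext s
        have : (x, s) ∈ wedge a b α γ ↔ s ∈ Set.Ioo (α * x) (γ * x) :=
          ⟨fun h => h.2.2, fun h => ⟨hx.1, hx.2, h⟩⟩
        by_cases hs : s ∈ Set.Ioo (α * x) (γ * x)
        · rw [Set.indicator_of_mem (this.2 hs), Set.indicator_of_mem hs]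
        · rw [Set.indicator_of_notMem (fun h => hs (this.1 h)), Set.indicator_of_notMem hs]
      rw [this, lintegral_indicator measurableSet_Ioo, setLIntegral_const, Real.volume_Ioo,
        ← ENNReal.ofReal_mul (by positivity), Set.indicator_of_mem hx]
      congr 1
      field_simp
    · rw [Set.indicator_of_notMem hx]
      have : (fun s : ℝ => (wedge a b α γ).indicator
        (fun z : ℝ × ℝ => ENNReal.ofReal (1 / z.1 ^ 2)) (x, s)) = fun _ => 0 := by
        ext s
        exact Set.indicator_of_notMem (fun h => hx ⟨h.1, h.2.1⟩) _
      rw [this, lintegral_zero]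
  simp_rw [hin]
  rw [lintegral_indicator measurableSet_Ioo, setLIntegral_congr Ioo_ae_eq_Ioc]
  have hc : ContinuousOn (fun x : ℝ => (γ - α) * (1 / x)) (Set.uIcc a b) := by
    rw [Set.uIcc_of_le hab]
    apply ContinuousOn.mul (by fun_prop)
    apply ContinuousOn.div (by fun_prop) (by fun_prop)
    intro x hx
    exact (ha.trans_le hx.1).ne'
  rw [← ofReal_integral_eq_lintegral_ofReal
    ((intervalIntegrable_iff_integrableOn_Ioc_of_le hab).1 hc.intervalIntegrable)]
  · rw [← intervalIntegral.integral_of_le hab, intervalIntegral.integral_const_mul,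
      integral_one_div_of_pos ha (ha.trans_le hab)]
  · filter_upwards [ae_restrict_mem measurableSet_Ioc] with x hx
    have : 0 < x := ha.trans hx.1
    have : 0 ≤ γ - α := by linarith
    positivity

lemma wedge_integrable (a b α γ : ℝ) (ha : 0 < a) (hab : a ≤ b) (h : α ≤ γ) :
    IntegrableOn (fun z : ℝ × ℝ => 1 / z.1 ^ 2) (wedge a b α γ) := by
  refine ⟨by apply Measurable.aestronglyMeasurable; fun_prop, ?_⟩
  rw [hasFiniteIntegral_iff_ofReal (Filter.Eventually.of_forall fun z => by positivity),
    wedge_lintegral a b α γ ha hab h]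
  exact ENNReal.ofReal_lt_top

lemma wedge_integral (a b α γ : ℝ) (ha : 0 < a) (hab : a ≤ b) (h : α ≤ γ) :
    ∫ z in wedge a b α γ, 1 / z.1 ^ 2 = (γ - α) * Real.log (b / a) := by
  rw [integral_eq_lintegral_of_nonneg_ae (Filter.Eventually.of_forall fun z => by positivity)
    (by apply Measurable.aestronglyMeasurable; fun_prop), wedge_lintegral a b α γ ha hab h,
    ENNReal.toReal_ofReal]
  have := Real.log_nonneg ((one_le_div ha).2 hab)
  have : 0 ≤ γ - α := by linarith
  positivity

lemma meas_lemma (f f₀ : ℝ × ℝ → ℝ) (hf₀ : Measurable f₀) 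
    (hf : ∀ r t : ℝ, 0 ≤ t → 1 + t ≤ r → ¬ IntegrableOn f (dAlembertRegion r t) → f (r, t) = f₀ (r, t))
    (R T : ℝ) (hRT : 1 + T ≤ R) :
    AEStronglyMeasurable f (volume.restrict (dAlembertRegion R T)) := by
  set G : Set (ℝ × ℝ) := {z | 0 ≤ z.2 ∧ 1 + z.2 ≤ z.1 ∧ IntegrableOn f (dAlembertRegion z.1 z.2)} with hG
  obtain ⟨D, hDG, hDc, hDU⟩ := TopologicalSpace.isOpen_biUnion_countable G
    (fun z => dAlembertRegion z.1 z.2) (fun z _ => isOpen_region _ _)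
  set O : Set (ℝ × ℝ) := ⋃ z ∈ G, dAlembertRegion z.1 z.2 with hO
  have hOo : IsOpen O := isOpen_biUnion (fun z _ => isOpen_region _ _)
  have hfO : AEStronglyMeasurable f (volume.restrict O) := by
    rw [← hDU]
    have := hDc.to_subtype
    rw [Set.biUnion_eq_iUnion, aestronglyMeasurable_iUnion_iff]
    intro z
    exact (hDG z.2).2.2.1
  set B : Set (ℝ × ℝ) := {z | 0 < z.2} ∩ Oᶜ ∩ ⋂ q : ℚ, {z | ((q : ℝ) < z.2 ∧ 0 < (q : ℝ)) → (z.1, (q : ℝ)) ∈ O} with hB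
  have hBm : MeasurableSet B := by
    refine ((measurableSet_lt (by fun_prop) (by fun_prop)).inter hOo.measurableSet.compl).inter ?_
    refine MeasurableSet.iInter fun q => ?_
    have e : {z : ℝ × ℝ | ((q : ℝ) < z.2 ∧ 0 < (q : ℝ)) → (z.1, (q : ℝ)) ∈ O} =
      ({z : ℝ × ℝ | (q : ℝ) < z.2} ∩ {z : ℝ × ℝ | 0 < (q : ℝ)})ᶜ ∪ (fun z : ℝ × ℝ => (z.1, (q : ℝ))) ⁻¹' O := by
      ext z
      simp only [Set.mem_ofPred_eq, Set.mem_union, Set.mem_compl_iff, Set.mem_inter_iff, Set.mem_preimage]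
      tauto
    rw [e]
    refine (((measurableSet_lt (by fun_prop) (by fun_prop)).inter (MeasurableSet.const _)).compl).union ?_
    exact measurableSet_preimage (by fun_prop) hOo.measurableSet
  have key : ∀ x s s' : ℝ, (x, s) ∈ B → (x, s') ∈ B → s < s' → False := by
    rintro x s s' ⟨⟨h0, h1⟩, -⟩ ⟨-, h2⟩ hlt
    obtain ⟨q, hq1, hq2⟩ := exists_rat_btwn hlt
    simp only [Set.mem_ofPred_eq] at h0
    have h3 := Set.mem_iInter.1 h2 q ⟨hq2, h0.trans hq1⟩
    apply h1
    simp only [hO, Set.mem_iUnion] at h3 ⊢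
    obtain ⟨g, hg, hgm⟩ := h3
    obtain ⟨a, b, d⟩ := region_facts hgm
    simp only at a b d
    refine ⟨g, hg, ⟨?_, ?_, ?_⟩⟩ <;> simp only <;> linarith
  have hB0 : volume B = 0 := by
    rw [Measure.volume_eq_prod, Measure.measure_prod_null hBm]
    filter_upwards with x
    apply Set.Subsingleton.measure_zero
    intro s hs s' hs'
    rcases lt_trichotomy s s' with h | h | h
    · exact (key x s s' hs hs' h).elim
    · exact h
    · exact (key x s' s hs' hs h).elim
  have hrest : AEStronglyMeasurable f (volume.restrict (dAlembertRegion R T \ O)) := by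
    refine hf₀.aestronglyMeasurable.congr ?_
    have hms : MeasurableSet (dAlembertRegion R T \ O) :=
      (isOpen_region R T).measurableSet.diff hOo.measurableSet
    have hBn : ∀ᵐ z ∂(volume.restrict (dAlembertRegion R T \ O)), z ∉ B :=
      ae_restrict_of_ae (measure_eq_zero_iff_ae_notMem.1 hB0)
    filter_upwards [ae_restrict_mem hms, hBn] with z hz hzB
    obtain ⟨a, b, d⟩ := region_facts hz.1
    symm
    refine hf z.1 z.2 d.le (by linarith) fun hint => hzB ⟨⟨d, hz.2⟩, ?_⟩
    refine Set.mem_iInter.2 fun q hq => ?_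
    simp only [hO, Set.mem_iUnion]
    refine ⟨z, ⟨d.le, by linarith, hint⟩, ⟨?_, ?_, ?_⟩⟩ <;> simp only <;> linarith [hq.1, hq.2]
  refine AEStronglyMeasurable.mono_set (t := O ∪ (dAlembertRegion R T \ O)) ?_ ?_
  · intro z hz
    by_cases h : z ∈ O
    · exact Or.inl h
    · exact Or.inr ⟨hz, h⟩
  · exact aestronglyMeasurable_union_iff.2 ⟨hfO, hrest⟩

lemma case_three (c : ℝ) (w : ℝ → ℝ → ℝ) (hc : 0 < c) (hc0 : c < 1 / 8000)
    (hrep : ∀ r t : ℝ, 0 ≤ t → 1 + t ≤ r →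
      w r t = c - (∫ z in dAlembertRegion r t, w z.1 z.2 ^ 3 / z.1 ^ 2) / 2)
    (hb : ∀ r t : ℝ, 0 ≤ t → 1 + t ≤ r → |w r t| ≤ 3 * c) : False := by
  set f : ℝ × ℝ → ℝ := fun z => w z.1 z.2 ^ 3 / z.1 ^ 2 with hfdef
  have hb3 : ∀ r t : ℝ, 0 ≤ t → 1 + t ≤ r → |w r t ^ 3| ≤ 27 * c ^ 3 := by
    intro r t ht hr
    rw [abs_pow]
    calc |w r t| ^ 3 ≤ (3 * c) ^ 3 := by gcongr; exact hb r t ht hr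
      _ = _ := by ring
  -- the pointwise bound of the integrand
  have hfb : ∀ z : ℝ × ℝ, 0 ≤ z.2 → 1 + z.2 ≤ z.1 → |f z| ≤ 27 * c ^ 3 / z.1 ^ 2 := by
    intro z h1 h2
    have hz : 0 < z.1 := by linarith
    simp only [hfdef]
    rw [abs_div, abs_of_pos (pow_pos hz 2)]
    gcongr
    exact hb3 _ _ h1 h2
  -- lower bound near the initial line
  have hlow : ∀ r t : ℝ, 0 ≤ t → 1 + t ≤ r → r ≤ 864 * (r - t) → c / 2 ≤ w r t := by
    intro r t ht hr hA
    have hvol := region_volume_le r t ht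
    have hI : ‖∫ z in dAlembertRegion r t, f z‖ ≤
        27 * c ^ 3 / (r - t) ^ 2 * volume.real (dAlembertRegion r t) := by
      refine norm_setIntegral_le_of_norm_le_const (hvol.trans_lt ENNReal.ofReal_lt_top) ?_
      intro z hz
      obtain ⟨a, b, d⟩ := region_facts hz
      rw [Real.norm_eq_abs]
      refine (hfb z d.le (by linarith)).trans ?_
      have : 0 < r - t := by linarith
      gcongr
      linarith
    have hv : volume.real (dAlembertRegion r t) ≤ 2 * t ^ 2 :=
      ENNReal.toReal_le_of_le_ofReal (by positivity) hvol
    have hrt : 0 < r - t := by linarith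
    have h2 : 27 * c ^ 3 / (r - t) ^ 2 * volume.real (dAlembertRegion r t) ≤
        27 * c ^ 3 * (2 * 864 ^ 2) := by
      rw [div_mul_eq_mul_div, div_le_iff₀ (by positivity), mul_assoc]
      have : t ^ 2 ≤ (864 * (r - t)) ^ 2 := by gcongr; linarith
      have h3 : volume.real (dAlembertRegion r t) ≤ 2 * 864 ^ 2 * (r - t) ^ 2 := by nlinarith
      calc _ ≤ 27 * c ^ 3 * (2 * 864 ^ 2 * (r - t) ^ 2) := by
            rw [mul_assoc 27]
            have := mul_le_mul_of_nonneg_left h3 (by positivity : 0 ≤ 27 * c ^ 3)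
            linarith
        _ = _ := by ring
    rw [hrep r t ht hr]
    rw [Real.norm_eq_abs] at hI
    have h4 := (le_abs_self _).trans (hI.trans h2)
    have h5 : c ^ 2 ≤ (1 / 8000) ^ 2 := by gcongr
    have h6 : c ^ 3 ≤ c * (1 / 8000) ^ 2 := by
      rw [show c ^ 3 = c * c ^ 2 by ring]; gcongr
    nlinarith
  -- integrability
  have hmeas : ∀ R T : ℝ, 1 + T ≤ R →
      AEStronglyMeasurable f (volume.restrict (dAlembertRegion R T)) := by
    intro R T hRT
    refine meas_lemma f (fun z => c ^ 3 / z.1 ^ 2) (by fun_prop) ?_ R T hRT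
    intro r t ht hr hn
    have := hrep r t ht hr
    rw [integral_undef hn] at this
    simp only [hfdef]
    rw [this]; ring
  have main : ∀ R : ℝ, 2 ≤ R → (1 / 16) * Real.log (R / 2) - (1 / 32) * Real.log (2 * R) ≤ 8 / c ^ 2 := by
    intro R hR
    set Ω := dAlembertRegion R (R - 1) with hΩ
    set P := wedge 2 R 0 (1 / 2) with hP
    set Q := wedge 1 (2 * R) (1 - 1 / 864) 1 with hQ
    have hPm : MeasurableSet P := wedge_measurable _ _ _ _
    have hQm : MeasurableSet Q := wedge_measurable _ _ _ _
    have hΩm : MeasurableSet Ω := (isOpen_region _ _).measurableSet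
    have hPi := wedge_integrable 2 R 0 (1 / 2) (by norm_num) hR (by norm_num)
    have hQi := wedge_integrable 1 (2 * R) (1 - 1 / 864) 1 (by norm_num) (by linarith) (by norm_num)
    have hPI := wedge_integral 2 R 0 (1 / 2) (by norm_num) hR (by norm_num)
    have hQI := wedge_integral 1 (2 * R) (1 - 1 / 864) 1 (by norm_num) (by linarith) (by norm_num)
    set k : ℝ × ℝ → ℝ := fun z => 1 / z.1 ^ 2 with hk
    have hk0 : ∀ z, 0 ≤ k z := fun z => by simp only [hk]; positivity
    have hPΩ : P ⊆ Ω := by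
      rintro z ⟨h1, h2, h3, h4⟩
      refine ⟨?_, ?_, ?_⟩ <;> linarith
    have hPi' : Integrable (P.indicator k) := (integrable_indicator_iff hPm).2 hPi
    have hQi' : Integrable (Q.indicator k) := (integrable_indicator_iff hQm).2 hQi
    have hfi : IntegrableOn f Ω := by
      refine IntegrableOn.of_bound
        ((region_volume_le R (R - 1) (by linarith)).trans_lt ENNReal.ofReal_lt_top)
        (hmeas R (R - 1) (by linarith)) (27 * c ^ 3) ?_
      filter_upwards [ae_restrict_mem hΩm] with z hz
      obtain ⟨a, b, d⟩ := region_facts hz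
      refine (hfb z d.le (by linarith)).trans ?_
      apply div_le_self (by positivity)
      apply one_le_pow₀
      linarith
    have hlower : ∫ z in Ω, (c ^ 3 / 8 * P.indicator k z - 27 * c ^ 3 * Q.indicator k z) ≤
        ∫ z in Ω, f z := by
      refine setIntegral_mono_on ((hPi'.const_mul _).sub (hQi'.const_mul _)).integrableOn hfi hΩm ?_
      intro z hz
      obtain ⟨a, b, d⟩ := region_facts hz
      have hz1 : 1 + z.2 ≤ z.1 := by linarith
      have hz0 : 0 < z.1 := by linarith
      by_cases hA : z.1 ≤ 864 * (z.1 - z.2)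
      · have hw := hlow z.1 z.2 d.le hz1 hA
        have hzQ : z ∉ Q := by
          rintro ⟨-, -, h3, -⟩
          linarith
        rw [Set.indicator_of_notMem hzQ]
        have h1 : P.indicator k z ≤ k z := Set.indicator_le_self' (fun _ _ => hk0 _) z
        have h2 : c ^ 3 / 8 ≤ w z.1 z.2 ^ 3 := by
          calc c ^ 3 / 8 = (c / 2) ^ 3 := by ring
            _ ≤ _ := by gcongr
        calc _ = c ^ 3 / 8 * P.indicator k z := by ring
          _ ≤ c ^ 3 / 8 * k z := by gcongr
          _ ≤ w z.1 z.2 ^ 3 * k z := by gcongr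
          _ = f z := by simp only [hfdef, hk]; ring
      · have hzQ : z ∈ Q := by
          refine ⟨by linarith, by linarith, by linarith, by linarith⟩
        have hzP : z ∉ P := by
          rintro ⟨-, -, -, h4⟩
          linarith
        rw [Set.indicator_of_mem hzQ, Set.indicator_of_notMem hzP]
        have := (abs_le.1 (hfb z d.le hz1)).1
        simp only [hk]
        calc _ = -(27 * c ^ 3 / z.1 ^ 2) := by ring
          _ ≤ _ := this
    rw [integral_sub (hPi'.const_mul _).integrableOn (hQi'.const_mul _).integrableOn,
      integral_const_mul, integral_const_mul, setIntegral_indicator hPm,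
      Set.inter_eq_self_of_subset_right hPΩ, hPI] at hlower
    have hQle : ∫ z in Ω, Q.indicator k z ≤ ∫ z in Q, k z := by
      rw [← integral_indicator hQm]
      exact setIntegral_le_integral hQi' (Filter.Eventually.of_forall fun z => Set.indicator_nonneg (fun _ _ => hk0 _) z)
    rw [hQI, div_one] at hQle
    have hR1 := hrep R (R - 1) (by linarith) (by linarith)
    have hR2 := (abs_le.1 (hb R (R - 1) (by linarith) (by linarith))).1
    have hIle : ∫ z in Ω, f z ≤ 8 * c := by
      simp only [hfdef, hΩ]; linarith
    have hc3 : 0 < c ^ 3 := by positivity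
    have h7 : c ^ 3 * ((1 / 16) * Real.log (R / 2) - (1 / 32) * Real.log (2 * R)) ≤ 8 * c := by
      have := mul_le_mul_of_nonneg_left hQle (by positivity : 0 ≤ 27 * c ^ 3)
      linarith
    rw [le_div_iff₀ (by positivity)]
    have : c * (((1 / 16) * Real.log (R / 2) - (1 / 32) * Real.log (2 * R)) * c ^ 2) ≤ c * 8 := by
      linarith
    exact le_of_mul_le_mul_left this hc
  have hL := Real.log_pos (by norm_num : (1 : ℝ) < 2)
  set L := 3 * Real.log 2 + 32 * (8 / c ^ 2) + 1 with hLdef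
  have hcc : 0 < 8 / c ^ 2 := by positivity
  have hR : 2 ≤ Real.exp L := by
    rw [← Real.log_le_iff_le_exp (by norm_num)]
    linarith
  have := main (Real.exp L) hR
  rw [Real.log_div (Real.exp_pos _).ne' (by norm_num), Real.log_mul (by norm_num) (Real.exp_pos _).ne',
    Real.log_exp] at this
  linarith

lemma case_gt (p : ℝ) (hp3 : 3 < p) (hp5 : p < 5) :
    ∃ c₀ : ℝ, 0 < c₀ ∧
      ∀ (c : ℝ) (w : ℝ → ℝ → ℝ), 0 < c → c < c₀ →
        (∀ r t : ℝ, 0 ≤ t → 1 + t ≤ r →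
          w r t = c * ((r - t) ^ (1 - 2 / (p - 1)) + (r + t) ^ (1 - 2 / (p - 1))) / 2
            - (∫ z in dAlembertRegion r t,
                |w z.1 z.2| ^ (p - 1) * w z.1 z.2 / z.1 ^ (p - 1)) / 2) →
        (∀ r t : ℝ, 0 ≤ t → 1 + t ≤ r → |w r t| ≤ 3 * c * r ^ (1 - 2 / (p - 1))) →
        ∀ r t : ℝ, 0 ≤ t → 1 + t ≤ r →
          (c / 2) * r ^ (1 - 2 / (p - 1)) ≤ w r t := by
  set β := 1 - 2 / (p - 1) with hβ
  have hp1 : 0 < p - 1 := by linarith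
  have hβ0 : 0 < β := by
    rw [hβ, sub_pos, div_lt_one hp1]; linarith
  have hβ1 : β < 1 := by
    have : 0 < 2 / (p - 1) := by positivity
    linarith
  set K := 1 / (β * (1 - β)) with hK
  have hKpos : 0 < K := by
    have : 0 < 1 - β := by linarith
    positivity
  set m : ℝ := 2 ^ β - 1 with hm
  have hmpos : 0 < m := sub_pos.2 (Real.one_lt_rpow (by norm_num) hβ0)
  have hlim : ∃ c₀ : ℝ, 0 < c₀ ∧ c₀ ^ (p - 1) = m / (3 ^ p * K) := by
    refine ⟨(m / (3 ^ p * K)) ^ (p - 1)⁻¹, by positivity, ?_⟩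
    rw [← Real.rpow_mul (by positivity), inv_mul_cancel₀ hp1.ne', Real.rpow_one]
  obtain ⟨c₀, hc₀, hc₀e⟩ := hlim
  refine ⟨c₀, hc₀, ?_⟩
  intro c w hc hcc hrep hb r t ht hr
  have hI : |∫ z in dAlembertRegion r t, |w z.1 z.2| ^ (p - 1) * w z.1 z.2 / z.1 ^ (p - 1)| ≤
      (3 * c) ^ p * (r ^ β * K) := by
    rw [← Real.norm_eq_abs]
    have hrn : 0 ≤ r ^ β := Real.rpow_nonneg (by linarith) _
    refine (norm_integral_le_lintegral_norm _).trans ?_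
    refine ENNReal.toReal_le_of_le_ofReal (by positivity) ?_
    calc _ ≤ ∫⁻ z in dAlembertRegion r t, ENNReal.ofReal ((3 * c) ^ p) * ENNReal.ofReal (z.1 ^ (β - 2)) := by
          refine setLIntegral_mono (by fun_prop) ?_
          intro z hz
          obtain ⟨a, b, d⟩ := region_facts hz
          have hz0 : 0 < z.1 := by linarith
          rw [← ENNReal.ofReal_mul (by positivity)]
          apply ENNReal.ofReal_le_ofReal
          rw [Real.norm_eq_abs, abs_div, abs_mul, abs_of_nonneg (Real.rpow_nonneg (abs_nonneg _) _),
            abs_of_pos (Real.rpow_pos_of_pos hz0 _), div_le_iff₀ (by positivity)]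
          have e1 : |w z.1 z.2| ^ (p - 1) * |w z.1 z.2| = |w z.1 z.2| ^ p := by
            rw [← Real.rpow_add_one' (abs_nonneg _) (by linarith)]
            congr 1; ring
          rw [e1]
          calc |w z.1 z.2| ^ p ≤ (3 * c * z.1 ^ β) ^ p := by
                apply Real.rpow_le_rpow (abs_nonneg _) (hb _ _ d.le (by linarith)) (by linarith)
            _ = (3 * c) ^ p * z.1 ^ (β - 2) * z.1 ^ (p - 1) := by
                rw [Real.mul_rpow (by positivity) (by positivity), ← Real.rpow_mul hz0.le, mul_assoc,
                  ← Real.rpow_add hz0]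
                congr 2
                rw [hβ]
                field_simp
                ring
      _ = ENNReal.ofReal ((3 * c) ^ p) * ∫⁻ z in dAlembertRegion r t, ENNReal.ofReal (z.1 ^ (β - 2)) := by
          rw [lintegral_const_mul _ (by fun_prop)]
      _ ≤ ENNReal.ofReal ((3 * c) ^ p) * ENNReal.ofReal (r ^ β / (β * (1 - β))) := by
          gcongr
          exact region_lintegral_le β r t hβ0 hβ1 ht hr
      _ = _ := by
          rw [← ENNReal.ofReal_mul (by positivity), hK, mul_one_div]
  have hrn : 0 < r ^ β := Real.rpow_pos_of_pos (by linarith) _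
  have hcp : (3 * c) ^ p * K ≤ c * m := by
    have h1 : c ^ (p - 1) ≤ m / (3 ^ p * K) := by
      rw [← hc₀e]
      exact Real.rpow_le_rpow hc.le hcc.le hp1.le
    have h2 : c ^ p = c ^ (p - 1) * c := by
      rw [← Real.rpow_add_one hc.ne']; congr 1; ring
    rw [Real.mul_rpow (by norm_num) hc.le, h2]
    have h3 : (0 : ℝ) < 3 ^ p := by positivity
    rw [le_div_iff₀ (by positivity)] at h1
    nlinarith
  rw [hrep r t ht hr]
  have h1 := (le_abs_self _).trans hI
  have h2 : (3 * c) ^ p * (r ^ β * K) ≤ c * m * r ^ β := by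
    calc _ = ((3 * c) ^ p * K) * r ^ β := by ring
      _ ≤ _ := by gcongr
  have hsub : (1 + m) * r ^ β ≤ (r - t) ^ β + (r + t) ^ β := by
    have := Real.rpow_add_le_add_rpow (a := r - t) (b := r + t) (p := β)
      (by linarith) (by linarith) hβ0.le hβ1.le
    rw [show r - t + (r + t) = 2 * r by ring, Real.mul_rpow (by norm_num) (by linarith)] at this
    rw [hm]
    linarith
  nlinarith

/-- Lower bound for the explicit example: with initial data `c r^β` for
`r ≥ 1`, zero initial velocity, and the a priori bound `|w| ≤ 3c r^β` in the
exterior region, one has `w(r,t) ≥ (c/2) r^β` for `r ≥ 1 + t`, hence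
`u = w/r ≥ (c/2) r^{-2/(p-1)}` there, provided `c` is small. -/
theorem example_lower_bound (p : ℝ) (hp3 : 3 ≤ p) (hp5 : p < 5) :
    ∃ c₀ : ℝ, 0 < c₀ ∧
      ∀ (c : ℝ) (w : ℝ → ℝ → ℝ), 0 < c → c < c₀ →
        (∀ r : ℝ, 1 ≤ r → w r 0 = c * r ^ (1 - 2 / (p - 1))) →
        -- d'Alembert representation with zero initial velocity
        (∀ r t : ℝ, 0 ≤ t → 1 + t ≤ r →
          w r t = c * ((r - t) ^ (1 - 2 / (p - 1)) + (r + t) ^ (1 - 2 / (p - 1))) / 2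
            - (∫ z in dAlembertRegion r t,
                |w z.1 z.2| ^ (p - 1) * w z.1 z.2 / z.1 ^ (p - 1)) / 2) →
        -- a priori bound
        (∀ r t : ℝ, 0 ≤ t → 1 + t ≤ r → |w r t| ≤ 3 * c * r ^ (1 - 2 / (p - 1))) →
        ∀ r t : ℝ, 0 ≤ t → 1 + t ≤ r →
          (c / 2) * r ^ (1 - 2 / (p - 1)) ≤ w r t ∧
          (c / 2) * r ^ (-2 / (p - 1)) ≤ w r t / r := by
  suffices H : ∃ c₀ : ℝ, 0 < c₀ ∧
      ∀ (c : ℝ) (w : ℝ → ℝ → ℝ), 0 < c → c < c₀ →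
        (∀ r t : ℝ, 0 ≤ t → 1 + t ≤ r →
          w r t = c * ((r - t) ^ (1 - 2 / (p - 1)) + (r + t) ^ (1 - 2 / (p - 1))) / 2
            - (∫ z in dAlembertRegion r t,
                |w z.1 z.2| ^ (p - 1) * w z.1 z.2 / z.1 ^ (p - 1)) / 2) →
        (∀ r t : ℝ, 0 ≤ t → 1 + t ≤ r → |w r t| ≤ 3 * c * r ^ (1 - 2 / (p - 1))) →
        ∀ r t : ℝ, 0 ≤ t → 1 + t ≤ r →
          (c / 2) * r ^ (1 - 2 / (p - 1)) ≤ w r t by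
    obtain ⟨c₀, h0, H⟩ := H
    refine ⟨c₀, h0, fun c w hc hcc _ hrep hb r t ht hr => ?_⟩
    have h := H c w hc hcc hrep hb r t ht hr
    have hr0 : 0 < r := by linarith
    refine ⟨h, ?_⟩
    rw [le_div_iff₀ hr0, mul_assoc, ← Real.rpow_add_one hr0.ne']
    rwa [show -2 / (p - 1) + 1 = 1 - 2 / (p - 1) by ring]
  rcases hp3.eq_or_lt with h | h
  · subst h
    refine ⟨1 / 8000, by norm_num, fun c w hc hcc hrep hb r t ht hr => ?_⟩
    exfalso
    have e0 : (1 : ℝ) - 2 / (3 - 1) = 0 := by norm_num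
    have e2 : (3 : ℝ) - 1 = 2 := by norm_num
    simp only [e0, Real.rpow_zero, mul_one] at hrep hb
    simp only [e2, Real.rpow_two, sq_abs] at hrep
    refine case_three c w hc hcc (fun r t ht hr => ?_) hb
    have := hrep r t ht hr
    simp only [← pow_succ] at this
    rw [this]
    norm_num
  · exact case_gt p h hp5
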